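/- arXiv:2211.04136 — 2 statements merged into one kernel-verified Lean document; each statement's English description precedes it below -/
import Mathlib

section
/- Let l be a positive integer and set αᵢ = 2πi/l for i = 0, 1, …, l, so all sector angles are equal to 2π/l. Let M₀ = ⋃_{i=1}^{l} {t·(cos αᵢ, sin αᵢ) : t ≥ 0} ⊆ ℝ², and let m̂ : ℝ² → ℝ² be any measurable function such that for Lebesgue-almost every w, m̂(w) ∈ M₀ and ‖w − m̂(w)‖ = inf{‖w − m‖ : m ∈ M₀}. Then 2·∫_{ℝ²} ⟪w, m̂(w)⟫ · (2π)⁻¹ · exp(−‖w‖²/2) dw = 1 if l = 1, and = 2 + (l/π)·sin(2π/l) if l ≥ 2. -/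
open Real MeasureTheory RealInnerProductSpace

/-- The point `(a, b)` of the Euclidean plane. -/
noncomputable def pt (a b : ℝ) : EuclideanSpace ℝ (Fin 2) :=
  (WithLp.equiv 2 (Fin 2 → ℝ)).symm ![a, b]

lemma inner_pt (w : EuclideanSpace ℝ (Fin 2)) (a b : ℝ) : ⟪w, pt a b⟫ = w 0 * a + w 1 * b := by
  simp [pt, PiLp.inner_apply, Fin.sum_univ_two]
  ring

lemma norm_pt_sq (a b : ℝ) : ‖pt a b‖ ^ 2 = a ^ 2 + b ^ 2 := by
  simp [pt, EuclideanSpace.norm_sq_eq, Fin.sum_univ_two]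

lemma cos_le_aux (l : ℕ) (hl : 0 < l) (φ : ℝ) (h1 : -(π / l) ≤ φ) (h2 : φ ≤ π / l) (m : ℤ) :
    Real.cos (φ - m * (2 * π / l)) ≤ Real.cos φ := by
  have hl0 : (0 : ℝ) < l := by exact_mod_cast hl
  have hl1 : (1 : ℝ) ≤ l := by exact_mod_cast hl
  have hpi := Real.pi_pos
  have hpl : π / l ≤ π := div_le_self hpi.le hl1
  have hpl0 : 0 < π / l := by positivity
  have hll : (l : ℝ) * (π / l) = π := by field_simp
  set q := m / (l : ℤ) with hq
  set j := m % (l : ℤ) with hj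
  have hjl : j < l := Int.emod_lt_of_pos _ (by exact_mod_cast hl)
  have hj0 : 0 ≤ j := Int.emod_nonneg _ (by exact_mod_cast hl.ne')
  have hm : (m : ℝ) = j + l * q := by
    have := Int.emod_add_mul_ediv m l
    exact_mod_cast this.symm
  have e : φ - m * (2 * π / l) = (φ - j * (2 * π / l)) - q * (2 * π) := by
    rw [hm]; field_simp; ring
  rw [e, Real.cos_sub_int_mul_two_pi]
  rcases hj0.eq_or_lt with h | h
  · rw [← h]; simp
  have hj1 : (1 : ℝ) ≤ j := by exact_mod_cast h
  have hj2 : (j : ℝ) ≤ l - 1 := by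
    have : j + 1 ≤ (l : ℤ) := hjl
    have : (j : ℝ) + 1 ≤ l := by exact_mod_cast this
    linarith
  have e2 : φ - j * (2 * π / l) = - (2 * j * (π / l) - φ) := by ring
  rw [e2, Real.cos_neg]
  have hx1 : π / l ≤ 2 * j * (π / l) - φ := by nlinarith
  have hx2 : 2 * j * (π / l) - φ ≤ 2 * π - π / l := by nlinarith
  have hA : Real.cos (2 * j * (π / l) - φ) ≤ Real.cos (π / l) := by
    rcases le_total (2 * j * (π / l) - φ) π with h | h
    · exact Real.cos_le_cos_of_nonneg_of_le_pi hpl0.le h hx1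
    · rw [← Real.cos_two_pi_sub]
      exact Real.cos_le_cos_of_nonneg_of_le_pi hpl0.le (by linarith) (by linarith)
  have hB : Real.cos (π / l) ≤ Real.cos φ := by
    rw [← Real.cos_abs φ]
    exact Real.cos_le_cos_of_nonneg_of_le_pi (abs_nonneg _) hpl (abs_le.2 ⟨h1, h2⟩)
  exact hA.trans hB

lemma per_pos (l : ℕ) (hl : 0 < l) : 0 < 2 * π / (l : ℝ) := by
  have hl0 : (0 : ℝ) < l := by exact_mod_cast hl
  have hpi := Real.pi_pos
  positivity

/-- squared positive part of the cosine of the angle to the nearest ray -/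
noncomputable def FF (l : ℕ) (hl : 0 < l) (θ : ℝ) : ℝ :=
  (max 0 (Real.cos (toIocMod (per_pos l hl) (-(π / l)) θ))) ^ 2

lemma proj_inner (l : ℕ) (hl : 0 < l) (M₀ : Set (EuclideanSpace ℝ (Fin 2)))
    (hM₀ : M₀ = {w | ∃ i ∈ Finset.Icc 1 l, ∃ t : ℝ, 0 ≤ t ∧
      w = t • pt (Real.cos (2 * π * i / l)) (Real.sin (2 * π * i / l))})
    (w m : EuclideanSpace ℝ (Fin 2)) (hm : m ∈ M₀)
    (hinf : ‖w - m‖ = sInf ((fun m => ‖w - m‖) '' M₀)) (r θ : ℝ) (hr : 0 ≤ r)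
    (h0 : w 0 = r * Real.cos θ) (h1 : w 1 = r * Real.sin θ) :
    ⟪w, m⟫ = r ^ 2 * FF l hl θ := by
  have hl0 : (0 : ℝ) < l := by exact_mod_cast hl
  have hmin : ∀ m' ∈ M₀, ‖w - m‖ ^ 2 ≤ ‖w - m'‖ ^ 2 := by
    intro m' hm'
    gcongr
    rw [hinf]
    exact csInf_le ⟨0, by rintro _ ⟨x, -, rfl⟩; positivity⟩ ⟨m', hm', rfl⟩
  have hw (β : ℝ) : ⟪w, pt (Real.cos β) (Real.sin β)⟫ = r * Real.cos (θ - β) := by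
    rw [inner_pt, h0, h1, Real.cos_sub]; ring
  have hdist (β t : ℝ) : ‖w - t • pt (Real.cos β) (Real.sin β)‖ ^ 2
      = ‖w‖ ^ 2 - 2 * t * (r * Real.cos (θ - β)) + t ^ 2 := by
    rw [norm_sub_sq_real, inner_smul_right, hw, norm_smul, mul_pow, norm_pt_sq,
      Real.cos_sq_add_sin_sq]
    simp; ring
  subst hM₀
  obtain ⟨i, hi, t, ht, rfl⟩ := hm
  set φ := toIocMod (per_pos l hl) (-(π / l)) θ with hφ
  set k := toIocDiv (per_pos l hl) (-(π / l)) θ with hk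
  have hφk : θ = φ + k * (2 * π / l) := by
    have := self_sub_toIocDiv_zsmul (per_pos l hl) (-(π / l)) θ
    rw [zsmul_eq_mul] at this
    rw [hφ, ← this]; ring
  have hφm := toIocMod_mem_Ioc (per_pos l hl) (-(π / l)) θ
  have hφ2 : φ ≤ π / l := by
    have := hφm.2
    have e : -(π / l) + 2 * π / l = π / l := by ring
    rw [e] at this
    exact this
  have hφ1 : -(π / l) ≤ φ := hφm.1.le
  -- the closest ray
  obtain ⟨j, hj, q, hjq⟩ : ∃ j ∈ Finset.Icc 1 l, ∃ q : ℤ, (j : ℤ) = k + q * l := by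
    refine ⟨((k - 1) % (l : ℤ)).toNat + 1, ?_, - ((k - 1) / (l : ℤ)), ?_⟩
    · have h1 := Int.emod_lt_of_pos (k - 1) (show (0 : ℤ) < l by exact_mod_cast hl)
      have h2 := Int.emod_nonneg (k - 1) (show (l : ℤ) ≠ 0 by exact_mod_cast hl.ne')
      rw [Finset.mem_Icc]; omega
    · have h2 := Int.emod_nonneg (k - 1) (show (l : ℤ) ≠ 0 by exact_mod_cast hl.ne')
      have h3 := Int.emod_add_mul_ediv (k - 1) l
      push_cast
      rw [Int.toNat_of_nonneg h2]
      linarith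
  have hcj : Real.cos (θ - 2 * π * j / l) = Real.cos φ := by
    have hjR : (j : ℝ) = k + q * l := by exact_mod_cast hjq
    have : θ - 2 * π * j / l = φ - q * (2 * π) := by
      rw [hφk, hjR]; field_simp; ring
    rw [this, Real.cos_sub_int_mul_two_pi]
  have hci : Real.cos (θ - 2 * π * i / l) ≤ Real.cos φ := by
    have := cos_le_aux l hl φ hφ1 hφ2 ((i : ℤ) - k)
    have e : φ - (((i : ℤ) - k : ℤ) : ℝ) * (2 * π / l) = θ - 2 * π * i / l := by
      rw [hφk]; push_cast; ring
    rwa [e] at this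
  rw [inner_smul_right, hw]
  set c := Real.cos (θ - 2 * π * i / l) with hc
  have hFF : FF l hl θ = (max 0 (Real.cos φ)) ^ 2 := rfl
  rw [hFF]
  have A := hmin _ ⟨i, hi, max 0 (r * c), le_max_left _ _, rfl⟩
  have B := hmin _ ⟨j, hj, r * max 0 (Real.cos φ), by positivity, rfl⟩
  rw [hdist, hdist] at A B
  rw [hcj] at B
  rw [← hc] at A B
  have hmx : max 0 (Real.cos φ) * Real.cos φ = (max 0 (Real.cos φ)) ^ 2 := by
    rcases max_cases 0 (Real.cos φ) with ⟨h, _⟩ | ⟨h, _⟩ <;> rw [h] <;> ring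
  have hmx' : max 0 (r * c) * (r * c) = (max 0 (r * c)) ^ 2 := by
    rcases max_cases 0 (r * c) with ⟨h, _⟩ | ⟨h, _⟩ <;> rw [h] <;> ring
  have hle : max 0 (r * c) ≤ r * max 0 (Real.cos φ) := by
    apply max_le (by positivity)
    gcongr
    exact hci.trans (le_max_right _ _)
  have hle0 : 0 ≤ max 0 (r * c) := le_max_left _ _
  have ht2 : t = max 0 (r * c) := by
    have h5 : r * c ≤ max 0 (r * c) := le_max_right _ _
    have : (t - max 0 (r * c)) ^ 2 ≤ 0 := by nlinarith
    nlinarith [pow_eq_zero_iff (two_ne_zero) |>.1 (le_antisymm this (sq_nonneg _))]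
  have e : t * (r * c) = t ^ 2 := by rw [ht2]; exact hmx'
  rw [e]
  have e2 : r ^ 2 * max 0 (Real.cos φ) ^ 2 = (r * max 0 (Real.cos φ)) ^ 2 := by ring
  apply le_antisymm
  · rw [e2, ht2]; gcongr
  · nlinarith

lemma FF_eq (l : ℕ) (hl : 0 < l) (θ : ℝ) (h : θ ∈ Set.Ioc (-(π / l)) (π / l)) :
    FF l hl θ = (max 0 (Real.cos θ)) ^ 2 := by
  unfold FF
  rw [(toIocMod_eq_self (per_pos l hl)).2]
  have e : -(π / l) + 2 * π / l = π / l := by ring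
  rw [e]
  exact h

lemma integral_FF (l : ℕ) (hl : 0 < l) :
    ∫ θ in Set.Ioo (-π) π, FF l hl θ
      = l * ∫ θ in (-(π / l))..(π / l), (max 0 (Real.cos θ)) ^ 2 := by
  have hl0 : (0 : ℝ) < l := by exact_mod_cast hl
  have hpi := Real.pi_pos
  have hpl0 : 0 < π / l := by positivity
  have hper : Function.Periodic (FF l hl) (2 * π / l) := by
    intro θ
    unfold FF
    rw [toIocMod_add_right]
  have e : -(π / l) + 2 * π / l = π / l := by ring
  have hcont : Continuous fun θ : ℝ => (max 0 (Real.cos θ)) ^ 2 := by fun_prop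
  have hint0 : IntervalIntegrable (FF l hl) volume (-(π / l)) (-(π / l) + 2 * π / l) := by
    rw [e]
    refine (hcont.intervalIntegrable _ _).congr ?_
    intro θ hθ
    rw [Set.uIoc_of_le (by linarith)] at hθ
    exact (FF_eq l hl θ hθ).symm
  have hint := hper.intervalIntegrable (per_pos l hl).ne' hint0
  have h := hper.intervalIntegral_add_zsmul_eq (l : ℤ) (-π) hint
  have e2 : -π + (l : ℤ) • (2 * π / l) = π := by
    rw [zsmul_eq_mul]; push_cast; field_simp; ring
  rw [e2, hper.intervalIntegral_add_eq (-π) (-(π / l)), e] at h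
  rw [← integral_Ioc_eq_integral_Ioo, ← intervalIntegral.integral_of_le (by linarith), h]
  simp only [zsmul_eq_mul, Int.cast_natCast]
  congr 1
  apply intervalIntegral.integral_congr_ae
  refine Filter.Eventually.of_forall fun θ hθ => ?_
  rw [Set.uIoc_of_le (by linarith)] at hθ
  exact FF_eq l hl θ hθ

lemma integral_r : ∫ r in Set.Ioi (0 : ℝ), r ^ 3 * Real.exp (-r ^ 2 / 2) = 2 := by
  have h := integral_rpow_mul_exp_neg_mul_rpow (p := 2) (q := 3) (b := 1 / 2)
    (by norm_num) (by norm_num) (by norm_num)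
  have e : ∫ r in Set.Ioi (0 : ℝ), r ^ 3 * Real.exp (-r ^ 2 / 2)
      = ∫ x in Set.Ioi (0 : ℝ), x ^ (3 : ℝ) * Real.exp (-(1 / 2) * x ^ (2 : ℝ)) := by
    congr 1; ext x
    have h3 : x ^ (3 : ℝ) = x ^ 3 := by exact_mod_cast Real.rpow_natCast x 3
    have h2 : x ^ (2 : ℝ) = x ^ 2 := by exact_mod_cast Real.rpow_natCast x 2
    rw [h3, h2]; ring_nf
  rw [e, h]
  have : ((3 : ℝ) + 1) / 2 = 2 := by norm_num
  rw [this, Real.Gamma_two]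
  have : (-(3 + 1) / 2 : ℝ) = ((-2 : ℤ) : ℝ) := by norm_num
  rw [this, Real.rpow_intCast]
  norm_num

lemma int_max_one : ∫ θ in (-π)..π, (max 0 (Real.cos θ)) ^ 2 = π / 2 := by
  have hpi := Real.pi_pos
  have hcont : Continuous fun θ : ℝ => (max 0 (Real.cos θ)) ^ 2 := by fun_prop
  have hi := fun a b => hcont.intervalIntegrable (μ := volume) a b
  rw [← intervalIntegral.integral_add_adjacent_intervals (hi (-π) (-(π / 2))) (hi _ _),
    ← intervalIntegral.integral_add_adjacent_intervals (hi (-(π / 2)) (π / 2)) (hi _ _)]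
  have h1 : ∫ θ in (-π)..(-(π / 2)), (max 0 (Real.cos θ)) ^ 2 = ∫ θ in (-π)..(-(π / 2)), (0 : ℝ) := by
    apply intervalIntegral.integral_congr
    intro θ hθ
    rw [Set.uIcc_of_le (by linarith)] at hθ
    have : Real.cos θ ≤ 0 := by
      rw [← Real.cos_neg]
      exact Real.cos_nonpos_of_pi_div_two_le_of_le (by linarith [hθ.2]) (by linarith [hθ.1])
    simp [max_eq_left this]
  have h3 : ∫ θ in (π / 2)..π, (max 0 (Real.cos θ)) ^ 2 = ∫ θ in (π / 2)..π, (0 : ℝ) := by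
    apply intervalIntegral.integral_congr
    intro θ hθ
    rw [Set.uIcc_of_le (by linarith)] at hθ
    have : Real.cos θ ≤ 0 :=
      Real.cos_nonpos_of_pi_div_two_le_of_le (by linarith [hθ.1]) (by linarith [hθ.2])
    simp [max_eq_left this]
  have h2 : ∫ θ in (-(π / 2))..(π / 2), (max 0 (Real.cos θ)) ^ 2
      = ∫ θ in (-(π / 2))..(π / 2), Real.cos θ ^ 2 := by
    apply intervalIntegral.integral_congr
    intro θ hθ
    rw [Set.uIcc_of_le (by linarith)] at hθ
    have : 0 ≤ Real.cos θ := Real.cos_nonneg_of_mem_Icc hθ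
    simp [max_eq_right this]
  rw [h1, h2, h3, integral_cos_sq]
  simp

lemma int_max_two (l : ℕ) (hl : 2 ≤ l) : ∫ θ in (-(π / l))..(π / l), (max 0 (Real.cos θ)) ^ 2
    = π / l + Real.sin (2 * π / l) / 2 := by
  have hpi := Real.pi_pos
  have hl2 : (2 : ℝ) ≤ l := by exact_mod_cast hl
  have hpl0 : 0 < π / l := by positivity
  have hpl : π / l ≤ π / 2 := by gcongr
  have h2 : ∫ θ in (-(π / l))..(π / l), (max 0 (Real.cos θ)) ^ 2
      = ∫ θ in (-(π / l))..(π / l), Real.cos θ ^ 2 := by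
    apply intervalIntegral.integral_congr
    intro θ hθ
    rw [Set.uIcc_of_le (by linarith)] at hθ
    have : 0 ≤ Real.cos θ :=
      Real.cos_nonneg_of_mem_Icc ⟨by linarith [hθ.1], by linarith [hθ.2]⟩
    simp [max_eq_right this]
  rw [h2, integral_cos_sq]
  have : 2 * π / (l : ℝ) = 2 * (π / l) := by ring
  rw [this, Real.sin_two_mul, Real.cos_neg, Real.sin_neg]
  ring

lemma integral_plane (f : EuclideanSpace ℝ (Fin 2) → ℝ) :
    ∫ w, f w = ∫ p : ℝ × ℝ, f (pt p.1 p.2) := by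
  have h1 := (EuclideanSpace.volume_preserving_symm_measurableEquiv_toLp (Fin 2)).symm
  have h2 := (volume_preserving_finTwoArrow ℝ).symm
  rw [← h1.integral_comp (MeasurableEquiv.measurableEmbedding _),
    ← h2.integral_comp (MeasurableEquiv.measurableEmbedding _)]
  rfl

lemma main_integral (l : ℕ) (hl : 0 < l) (M₀ : Set (EuclideanSpace ℝ (Fin 2)))
    (hM₀ : M₀ = {w | ∃ i ∈ Finset.Icc 1 l, ∃ t : ℝ, 0 ≤ t ∧
      w = t • pt (Real.cos (2 * π * i / l)) (Real.sin (2 * π * i / l))})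
    (mhat : EuclideanSpace ℝ (Fin 2) → EuclideanSpace ℝ (Fin 2))
    (hproj : ∀ᵐ w : EuclideanSpace ℝ (Fin 2),
      mhat w ∈ M₀ ∧ ‖w - mhat w‖ = sInf ((fun m => ‖w - m‖) '' M₀)) :
    ∫ w : EuclideanSpace ℝ (Fin 2),
          ⟪w, mhat w⟫ * ((2 * π)⁻¹ * Real.exp (-‖w‖ ^ 2 / 2))
      = π⁻¹ * (l * ∫ θ in (-(π / l))..(π / l), (max 0 (Real.cos θ)) ^ 2) := by
  have step1 : ∫ w : EuclideanSpace ℝ (Fin 2),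
          ⟪w, mhat w⟫ * ((2 * π)⁻¹ * Real.exp (-‖w‖ ^ 2 / 2))
      = ∫ w : EuclideanSpace ℝ (Fin 2),
          (‖w‖ ^ 2 * FF l hl (Complex.arg ⟨w 0, w 1⟩)) *
            ((2 * π)⁻¹ * Real.exp (-‖w‖ ^ 2 / 2)) := by
    apply integral_congr_ae
    filter_upwards [hproj] with w hw
    have hn : ‖w‖ ^ 2 = ‖(⟨w 0, w 1⟩ : ℂ)‖ ^ 2 := by
      rw [← Complex.normSq_eq_norm_sq, Complex.normSq_apply, EuclideanSpace.norm_sq_eq,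
        Fin.sum_univ_two]
      simp; ring
    congr 1
    rw [hn]
    apply proj_inner l hl M₀ hM₀ w (mhat w) hw.1 hw.2 _ _ (norm_nonneg _)
    · rw [Complex.norm_mul_cos_arg]
    · rw [Complex.norm_mul_sin_arg]
  rw [step1, integral_plane, ← integral_comp_polarCoord_symm]
  have step2 : ∫ p in polarCoord.target, p.1 •
      ((‖pt (polarCoord.symm p).1 (polarCoord.symm p).2‖ ^ 2 *
        FF l hl (Complex.arg ⟨pt (polarCoord.symm p).1 (polarCoord.symm p).2 0,
          pt (polarCoord.symm p).1 (polarCoord.symm p).2 1⟩)) *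
            ((2 * π)⁻¹ * Real.exp (-‖pt (polarCoord.symm p).1 (polarCoord.symm p).2‖ ^ 2 / 2)))
      = ∫ p in Set.Ioi (0 : ℝ) ×ˢ Set.Ioo (-π) π,
        (p.1 ^ 3 * Real.exp (-p.1 ^ 2 / 2)) * ((2 * π)⁻¹ * FF l hl p.2) := by
    apply setIntegral_congr_fun (measurableSet_Ioi.prod measurableSet_Ioo)
    rintro ⟨r, θ⟩ ⟨hr, hθ⟩
    simp only [Set.mem_Ioi] at hr hθ
    have hn : ‖pt (r * Real.cos θ) (r * Real.sin θ)‖ ^ 2 = r ^ 2 := by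
      rw [norm_pt_sq]
      linear_combination r ^ 2 * Real.cos_sq_add_sin_sq θ
    have ha : Complex.arg ⟨pt (r * Real.cos θ) (r * Real.sin θ) 0,
          pt (r * Real.cos θ) (r * Real.sin θ) 1⟩ = θ := by
      refine Eq.trans ?_ (Complex.arg_mul_cos_add_sin_mul_I hr ⟨hθ.1, hθ.2.le⟩)
      congr 1
      apply Complex.ext <;> simp [pt, ← Complex.ofReal_cos, ← Complex.ofReal_sin]
    simp only [polarCoord_symm_apply, smul_eq_mul]
    rw [hn, ha]
    ring
  rw [step2, Measure.volume_eq_prod,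
    setIntegral_prod_mul (fun r : ℝ => r ^ 3 * Real.exp (-r ^ 2 / 2))
      (fun θ => (2 * π)⁻¹ * FF l hl θ), integral_r, integral_const_mul,
    integral_FF]
  rw [mul_inv]; ring

theorem equally_spaced_halflines_bias_correction
    (l : ℕ) (hl : 0 < l) (α : ℕ → ℝ)
    (hα : ∀ i ≤ l, α i = 2 * π * i / l)
    (M₀ : Set (EuclideanSpace ℝ (Fin 2)))
    (hM₀ : M₀ = {w | ∃ i ∈ Finset.Icc 1 l, ∃ t : ℝ, 0 ≤ t ∧
      w = t • pt (Real.cos (α i)) (Real.sin (α i))})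
    (mhat : EuclideanSpace ℝ (Fin 2) → EuclideanSpace ℝ (Fin 2))
    (hmeas : Measurable mhat)
    (hproj : ∀ᵐ w : EuclideanSpace ℝ (Fin 2),
      mhat w ∈ M₀ ∧ ‖w - mhat w‖ = sInf ((fun m => ‖w - m‖) '' M₀)) :
    (l = 1 →
      2 * (∫ w : EuclideanSpace ℝ (Fin 2),
          ⟪w, mhat w⟫ * ((2 * π)⁻¹ * Real.exp (-‖w‖ ^ 2 / 2))) = 1) ∧
    (2 ≤ l →
      2 * (∫ w : EuclideanSpace ℝ (Fin 2),
          ⟪w, mhat w⟫ * ((2 * π)⁻¹ * Real.exp (-‖w‖ ^ 2 / 2)))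
        = 2 + (l / π) * Real.sin (2 * π / l)) := by
  have hM' : M₀ = {w | ∃ i ∈ Finset.Icc 1 l, ∃ t : ℝ, 0 ≤ t ∧
      w = t • pt (Real.cos (2 * π * i / l)) (Real.sin (2 * π * i / l))} := by
    rw [hM₀]
    ext w
    simp only [Set.mem_ofPred_eq]
    refine exists_congr fun i => and_congr_right fun hi => ?_
    rw [hα i (Finset.mem_Icc.1 hi).2]
  have hl0 : (0 : ℝ) < l := by exact_mod_cast hl
  have hpi := Real.pi_pos
  rw [main_integral l hl M₀ hM' mhat hproj]
  constructor
  · intro h1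
    subst h1
    simp only [Nat.cast_one, div_one, one_mul]
    rw [int_max_one]
    field_simp
  · intro h2
    rw [int_max_two l h2]
    field_simp
end

section
/- Let φ ∈ (0, π]. Then (1/π)·∫_{0}^{φ} ∫_{0}^{∞} r³·c(θ)²·exp(−r²/2) dr dθ = (φ + sin φ)/π, where c(θ) = cos θ if θ ≤ φ/2 and c(θ) = cos(φ − θ) if θ > φ/2. -/
open Real MeasureTheory

lemma radial_aux : ∫ r in Set.Ioi (0:ℝ), r ^ 3 * Real.exp (-r ^ 2 / 2) = 2 := by
  have h := integral_rpow_mul_exp_neg_mul_rpow (p := 2) (q := 3) (b := 1/2)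
    (by norm_num) (by norm_num) (by norm_num)
  have e1 : (-(3 + 1) / 2 : ℝ) = ((-2 : ℤ) : ℝ) := by norm_num
  have e2 : ((3 + 1) / 2 : ℝ) = 2 := by norm_num
  rw [e1, e2, Real.rpow_intCast, Real.Gamma_two] at h
  have e3 : ((1/2 : ℝ) ^ (-2 : ℤ)) * (1 / 2) * 1 = 2 := by norm_num
  rw [e3] at h
  refine Eq.trans ?_ h
  refine setIntegral_congr_fun measurableSet_Ioi fun r _ => ?_
  have a : r ^ (3:ℝ) = r ^ 3 := by exact_mod_cast Real.rpow_natCast r 3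
  have b : r ^ (2:ℝ) = r ^ 2 := by exact_mod_cast Real.rpow_natCast r 2
  simp only [a, b]
  congr 2
  ring

lemma cos_aux (φ : ℝ) : ∫ θ in (0:ℝ)..(φ/2), Real.cos θ ^ 2 = (φ + Real.sin φ) / 4 := by
  have h : Real.sin φ = 2 * Real.sin (φ/2) * Real.cos (φ/2) := by
    rw [← Real.sin_two_mul]; congr 1; ring
  rw [integral_cos_sq, h]
  simp
  ring

theorem sector_integral (φ : ℝ) (hφ : φ ∈ Set.Ioc 0 π) :
    (1 / π) * ∫ θ in (0:ℝ)..φ, ∫ r in Set.Ioi (0:ℝ),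
        r ^ 3 * (if θ ≤ φ / 2 then Real.cos θ else Real.cos (φ - θ)) ^ 2
          * Real.exp (-r ^ 2 / 2)
      = (φ + Real.sin φ) / π := by
  have h0 : 0 < φ := hφ.1
  have inner : ∀ c : ℝ, ∫ r in Set.Ioi (0:ℝ), r ^ 3 * c ^ 2 * Real.exp (-r ^ 2 / 2)
      = 2 * c ^ 2 := by
    intro c
    refine Eq.trans ?_ (congrArg (fun t => t * c ^ 2) radial_aux)
    rw [← integral_mul_const]
    congr 1
    ext r
    ring
  simp only [inner]
  rw [intervalIntegral.integral_const_mul]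
  have c1 : Set.EqOn (fun θ => Real.cos θ ^ 2)
      (fun θ => (if θ ≤ φ / 2 then Real.cos θ else Real.cos (φ - θ)) ^ 2)
      (Set.uIoc 0 (φ/2)) := by
    intro θ hθ
    rw [Set.uIoc_of_le (by linarith)] at hθ
    simp [hθ.2]
  have c2 : Set.EqOn (fun θ => Real.cos (φ - θ) ^ 2)
      (fun θ => (if θ ≤ φ / 2 then Real.cos θ else Real.cos (φ - θ)) ^ 2)
      (Set.uIoc (φ/2) φ) := by
    intro θ hθ
    rw [Set.uIoc_of_le (by linarith)] at hθ
    simp [not_le.mpr hθ.1]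
  have i1 : IntervalIntegrable (fun θ => Real.cos θ ^ 2) volume 0 (φ/2) :=
    Continuous.intervalIntegrable (by fun_prop) _ _
  have i2 : IntervalIntegrable (fun θ => Real.cos (φ - θ) ^ 2) volume (φ/2) φ :=
    Continuous.intervalIntegrable (by fun_prop) _ _
  rw [← intervalIntegral.integral_add_adjacent_intervals (i1.congr c1) (i2.congr c2),
    ← intervalIntegral.integral_congr_ae (Filter.Eventually.of_forall c1), ← intervalIntegral.integral_congr_ae (Filter.Eventually.of_forall c2),
    intervalIntegral.integral_comp_sub_left (fun x => Real.cos x ^ 2) φ]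
  have e : φ - φ / 2 = φ / 2 := by ring
  rw [sub_self, e, cos_aux]
  ring
end
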